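/- arXiv:2512.12335 — 2 statements merged into one kernel-verified Lean document; each statement's English description precedes it below -/
import Mathlib

section
/- (Build-up Construction I.) Let C be a free E-linear code of length n with dim_{F₂}(C_Res) = k and hull-rank l, let r₁, …, r_k ∈ F₂ⁿ be a basis of C_Res, let u ∈ F₂ⁿ satisfy ⟨u, u⟩ = 1, and set vᵢ = ⟨u, rᵢ⟩ for 1 ≤ i ≤ k. Let D be the E-linear code of length n + 2 generated by the k + 1 vectors (κ, 0, κu₁, …, κu_n) and (κvᵢ, κvᵢ, κr_{i,1}, …, κr_{i,n}) for 1 ≤ i ≤ k. Then D is a free E-linear code of length n + 2 with dim_{F₂}(D_Res) = k + 1 and hull-rank l + 1. -/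
open scoped BigOperators

/-- The non-unital ring `E` of order 4: the pair `(u, v)` represents `uκ + vζ`,
where `ζ = κ + τ`.  Multiplication: `(uκ + vζ)·(u'κ + v'ζ) = u'·(uκ + vζ)`. -/
def RingE : Type := ZMod 2 × ZMod 2

namespace RingE

instance : AddCommGroup RingE := inferInstanceAs (AddCommGroup (ZMod 2 × ZMod 2))

instance : Mul RingE := ⟨fun a b => Prod.mk (Prod.fst a * Prod.fst b) (Prod.snd a * Prod.fst b)⟩

noncomputable instance : DecidableEq RingE := Classical.decEq _

instance : NonUnitalRing RingE where
  left_distrib a b c := by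
    show Prod.mk (Prod.fst a * (Prod.fst b + Prod.fst c))
        (Prod.snd a * (Prod.fst b + Prod.fst c)) = _
    show _ = Prod.mk (Prod.fst a * Prod.fst b + Prod.fst a * Prod.fst c)
        (Prod.snd a * Prod.fst b + Prod.snd a * Prod.fst c)
    simp [mul_add]
  right_distrib a b c := by
    show Prod.mk ((Prod.fst a + Prod.fst b) * Prod.fst c)
        ((Prod.snd a + Prod.snd b) * Prod.fst c) = _
    show _ = Prod.mk (Prod.fst a * Prod.fst c + Prod.fst b * Prod.fst c)
        (Prod.snd a * Prod.fst c + Prod.snd b * Prod.fst c)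
    simp [add_mul]
  zero_mul a := by
    show Prod.mk ((0 : ZMod 2) * Prod.fst a) ((0 : ZMod 2) * Prod.fst a) = ((0 : ZMod 2), (0 : ZMod 2))
    simp
  mul_zero a := by
    show Prod.mk (Prod.fst a * (0 : ZMod 2)) (Prod.snd a * (0 : ZMod 2)) = ((0 : ZMod 2), (0 : ZMod 2))
    simp
  mul_assoc a b c := by
    show Prod.mk (Prod.fst a * Prod.fst b * Prod.fst c) (Prod.snd a * Prod.fst b * Prod.fst c)
      = Prod.mk (Prod.fst a * (Prod.fst b * Prod.fst c)) (Prod.snd a * (Prod.fst b * Prod.fst c))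
    simp [mul_assoc]

/-- The generator `κ`. -/
def kappa : RingE := Prod.mk 1 0

/-- The generator `τ`. -/
def tau : RingE := Prod.mk 1 1

/-- `ζ = κ + τ`. -/
def zeta : RingE := Prod.mk 0 1

/-- The reduction map `π : E → F₂`, sending `uκ + vζ` to `u`. -/
def pi (a : RingE) : ZMod 2 := Prod.fst a

/-- `κ·c` for a scalar `c ∈ F₂`, i.e. the element `cκ` of `E`. -/
def kappaSMul (c : ZMod 2) : RingE := Prod.mk c 0

/-- `ζ·c` for a scalar `c ∈ F₂`, i.e. the element `cζ` of `E`. -/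
def zetaSMul (c : ZMod 2) : RingE := Prod.mk 0 c

end RingE

namespace ECode

/-- Componentwise reduction `π : Eⁿ → F₂ⁿ`. -/
def piVec {n : ℕ} (x : Fin n → RingE) : Fin n → ZMod 2 := fun i => RingE.pi (x i)

/-- The vector `κv ∈ Eⁿ` attached to `v ∈ F₂ⁿ`. -/
def kappaVec {n : ℕ} (v : Fin n → ZMod 2) : Fin n → RingE := fun i => RingE.kappaSMul (v i)

/-- The vector `ζv ∈ Eⁿ` attached to `v ∈ F₂ⁿ`. -/
def zetaVec {n : ℕ} (v : Fin n → ZMod 2) : Fin n → RingE := fun i => RingE.zetaSMul (v i)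

/-- An `E`-linear code of length `n`: a left `E`-submodule of `Eⁿ`, i.e. an additive
subgroup closed under componentwise left multiplication by elements of `E`. -/
def IsECode {n : ℕ} (C : Set (Fin n → RingE)) : Prop :=
  (0 : Fin n → RingE) ∈ C ∧ (∀ x ∈ C, ∀ y ∈ C, x + y ∈ C) ∧ (∀ x ∈ C, -x ∈ C) ∧
    ∀ (a : RingE), ∀ x ∈ C, (fun i => a * x i) ∈ C

/-- The residue code `C_Res = π(C)`. -/
def Res {n : ℕ} (C : Set (Fin n → RingE)) : Set (Fin n → ZMod 2) := piVec '' C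

/-- The torsion code `C_Tor = {v ∈ F₂ⁿ : ζv ∈ C}`. -/
def Tor {n : ℕ} (C : Set (Fin n → RingE)) : Set (Fin n → ZMod 2) := {v | zetaVec v ∈ C}

/-- A code is free if its residue and torsion codes coincide. -/
def IsFree {n : ℕ} (C : Set (Fin n → RingE)) : Prop := Res C = Tor C

/-- The inner product on `Eⁿ`. -/
def Einner {n : ℕ} (w z : Fin n → RingE) : RingE := ∑ i, w i * z i

/-- The left dual `C^{⊥L}`. -/
def dualL {n : ℕ} (C : Set (Fin n → RingE)) : Set (Fin n → RingE) :=
  {z | ∀ w ∈ C, Einner z w = 0}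

/-- The right dual `C^{⊥R}`. -/
def dualR {n : ℕ} (C : Set (Fin n → RingE)) : Set (Fin n → RingE) :=
  {z | ∀ w ∈ C, Einner w z = 0}

/-- The (two-sided) dual `C^⊥ = C^{⊥L} ∩ C^{⊥R}`. -/
def dualE {n : ℕ} (C : Set (Fin n → RingE)) : Set (Fin n → RingE) := dualL C ∩ dualR C

/-- The left hull `LHull(C) = C ∩ C^{⊥L}`. -/
def LHull {n : ℕ} (C : Set (Fin n → RingE)) : Set (Fin n → RingE) := C ∩ dualL C

/-- The right hull `RHull(C) = C ∩ C^{⊥R}`. -/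
def RHull {n : ℕ} (C : Set (Fin n → RingE)) : Set (Fin n → RingE) := C ∩ dualR C

/-- The hull `Hull(C) = C ∩ C^⊥`. -/
def EHull {n : ℕ} (C : Set (Fin n → RingE)) : Set (Fin n → RingE) := C ∩ dualE C

/-- The Euclidean inner product on `F₂ⁿ`. -/
def Finner {n : ℕ} (w z : Fin n → ZMod 2) : ZMod 2 := ∑ i, w i * z i

/-- The Euclidean dual of an `F₂`-linear code. -/
def dualF {n : ℕ} (B : Set (Fin n → ZMod 2)) : Set (Fin n → ZMod 2) :=
  {z | ∀ w ∈ B, Finner w z = 0}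

/-- The hull of an `F₂`-linear code. -/
def FHull {n : ℕ} (B : Set (Fin n → ZMod 2)) : Set (Fin n → ZMod 2) := B ∩ dualF B

/-- `F₂`-dimension of an `F₂`-linear code (as the dimension of its span). -/
noncomputable def dimF {n : ℕ} (B : Set (Fin n → ZMod 2)) : ℕ :=
  Module.finrank (ZMod 2) (Submodule.span (ZMod 2) B)

/-- Scalar multiplication of a vector of `Eⁿ` by `a ∈ E`. -/
def smulVec {n : ℕ} (a : RingE) (x : Fin n → RingE) : Fin n → RingE := fun i => a * x i

/-- The left `E`-span `⟨X⟩_E` of a finite set `X ⊆ Eⁿ`. -/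
def spanE {n : ℕ} (X : Finset (Fin n → RingE)) : Set (Fin n → RingE) :=
  {y | ∃ c : (Fin n → RingE) → RingE, y = ∑ x ∈ X, smulVec (c x) x}

/-- The additive (`F₂`-) span `⟨X⟩_{F₂}` of a finite set `X ⊆ Eⁿ`: all sums of subsets. -/
def spanF {n : ℕ} (X : Finset (Fin n → RingE)) : Set (Fin n → RingE) :=
  {y | ∃ S : Finset (Fin n → RingE), S ⊆ X ∧ y = ∑ x ∈ S, x}

/-- `X` is a generating set of the code `D` if `⟨X⟩_E ∪ ⟨X⟩_{F₂} = D`. -/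
def IsGenSet {n : ℕ} (X : Finset (Fin n → RingE)) (D : Set (Fin n → RingE)) : Prop :=
  spanE X ∪ spanF X = D

/-- The rank of a (free) code: the minimum cardinality of a generating set. -/
noncomputable def genRank {n : ℕ} (D : Set (Fin n → RingE)) : ℕ :=
  sInf {m | ∃ X : Finset (Fin n → RingE), X.card = m ∧ IsGenSet X D}

/-- Prepending two coordinates to a vector of length `n`. -/
def cons2 {n : ℕ} (a b : RingE) (x : Fin n → RingE) : Fin (n + 2) → RingE :=
  Fin.cons a (Fin.cons b x)

end ECode

namespace ECode

/-- componentwise `ζ`-coefficient -/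
def sigVec {n : ℕ} (x : Fin n → RingE) : Fin n → ZMod 2 := fun i => Prod.snd (x i)

/-- vectors both of whose coefficient vectors are in `W` -/
def bothIn {n : ℕ} (W : Submodule (ZMod 2) (Fin n → ZMod 2)) : AddSubgroup (Fin n → RingE) where
  carrier := {x | piVec x ∈ W ∧ sigVec x ∈ W}
  zero_mem' := ⟨W.zero_mem, W.zero_mem⟩
  add_mem' := fun ha hb => ⟨W.add_mem ha.1 hb.1, W.add_mem ha.2 hb.2⟩
  neg_mem' := fun ha => ⟨W.neg_mem ha.1, W.neg_mem ha.2⟩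

theorem kappaVec_mem {n : ℕ} (W : Submodule (ZMod 2) (Fin n → ZMod 2)) {w} (hw : w ∈ W) :
    kappaVec w ∈ bothIn W := ⟨hw, W.zero_mem⟩

theorem smulVec_mem {n : ℕ} (W : Submodule (ZMod 2) (Fin n → ZMod 2)) {w} (hw : w ∈ W)
    (a : RingE) : smulVec a (kappaVec w) ∈ bothIn W :=
  ⟨W.smul_mem (Prod.fst a) hw, W.smul_mem (Prod.snd a) hw⟩

/-- The code generated by `κ`-multiples. -/
theorem res_tor_of_gen {n : ℕ} (S : Set (Fin n → ZMod 2)) (X : Finset (Fin n → RingE))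
    (hX : (X : Set (Fin n → RingE)) = kappaVec '' S) (D : Set (Fin n → RingE)) (hD : IsECode D)
    (hgen : IsGenSet X D) :
    Res D = Submodule.span (ZMod 2) S ∧ Tor D = Submodule.span (ZMod 2) S := by
  set W := Submodule.span (ZMod 2) S with hW
  have h1 : ∀ x ∈ D, x ∈ bothIn W := by
    intro x hx
    have hXm : ∀ y ∈ X, ∃ w ∈ W, kappaVec w = y := by
      intro y hy
      have : y ∈ (X : Set (Fin n → RingE)) := hy
      rw [hX] at this
      obtain ⟨w, hw, rfl⟩ := this
      exact ⟨w, Submodule.subset_span hw, rfl⟩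
    rw [← hgen] at hx
    rcases hx with ⟨c, rfl⟩ | ⟨T, hT, rfl⟩
    · refine AddSubgroup.sum_mem _ fun y hy => ?_
      obtain ⟨w, hw, rfl⟩ := hXm y hy
      exact smulVec_mem W hw _
    · refine AddSubgroup.sum_mem _ fun y hy => ?_
      obtain ⟨w, hw, rfl⟩ := hXm y (hT hy)
      exact kappaVec_mem W hw
  have h2 : ∀ w ∈ W, kappaVec w ∈ D := by
    intro w hw
    induction hw using Submodule.span_induction with
    | mem x hx =>
      have : kappaVec x ∈ X := by
        have : kappaVec x ∈ (X : Set (Fin n → RingE)) := by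
          rw [hX]; exact ⟨x, hx, rfl⟩
        exact this
      rw [← hgen]
      exact Or.inr ⟨{kappaVec x}, by simpa using this, by simp⟩
    | zero => exact hD.1
    | add x y _ _ hx hy =>
      have := hD.2.1 _ hx _ hy
      convert this using 1
      funext i
      exact Prod.ext rfl (add_zero (0 : ZMod 2)).symm
    | smul a x _ hx =>
      have := hD.2.2.2 (RingE.kappaSMul a) _ hx
      convert this using 1
      funext i
      exact Prod.ext rfl (zero_mul (x i)).symm
  constructor
  · ext w
    constructor
    · rintro ⟨x, hx, rfl⟩
      exact (h1 x hx).1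
    · intro hw
      exact ⟨_, h2 w hw, rfl⟩
  · ext w
    constructor
    · intro hw
      exact (h1 _ hw).2
    · intro hw
      have := hD.2.2.2 RingE.zeta _ (h2 w hw)
      show zetaVec w ∈ D
      convert this using 1
      funext i
      exact Prod.ext (zero_mul (w i)).symm (one_mul (w i)).symm

/-- `x ↦ (⟨u,x⟩, ⟨u,x⟩, x)` -/
def phi {n : ℕ} (u : Fin n → ZMod 2) : (Fin n → ZMod 2) →ₗ[ZMod 2] (Fin (n + 2) → ZMod 2) where
  toFun x := Fin.cons (Finner u x) (Fin.cons (Finner u x) x)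
  map_add' x y := by
    funext i
    refine Fin.cases ?_ (fun i => Fin.cases ?_ (fun i => ?_) i) i <;>
      simp [Finner, mul_add, Finset.sum_add_distrib]
  map_smul' a x := by
    funext i
    refine Fin.cases ?_ (fun i => Fin.cases ?_ (fun i => ?_) i) i <;>
      simp [Finner, Finset.mul_sum, mul_left_comm]

/-- `(1, 0, u)` -/
def wzero {n : ℕ} (u : Fin n → ZMod 2) : Fin (n + 2) → ZMod 2 := Fin.cons 1 (Fin.cons 0 u)

theorem phi_injective {n : ℕ} (u : Fin n → ZMod 2) : Function.Injective (phi u) := by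
  intro x y h
  funext i
  have := congrFun h i.succ.succ
  simpa [phi] using this

theorem finrank_sup {n : ℕ} (u : Fin n → ZMod 2) (P : Submodule (ZMod 2) (Fin n → ZMod 2)) :
    Module.finrank (ZMod 2) ↥(Submodule.span (ZMod 2) {wzero u} ⊔ P.map (phi u))
      = Module.finrank (ZMod 2) P + 1 := by
  have hnot : wzero u ∉ P.map (phi u) := by
    rintro ⟨x, _, hx⟩
    have h0 := congrFun hx 0
    have h1 := congrFun hx (Fin.succ 0)
    simp only [phi, wzero, LinearMap.coe_mk, AddHom.coe_mk, Fin.cons_zero, Fin.cons_succ] at h0 h1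
    exact absurd (h0.symm.trans h1) (by decide)
  have hne : wzero u ≠ 0 := fun h => hnot (h ▸ Submodule.zero_mem _)
  have hdis : Submodule.span (ZMod 2) {wzero u} ⊓ P.map (phi u) = ⊥ := by
    rw [← disjoint_iff, disjoint_comm, Submodule.disjoint_span_singleton' hne]
    exact hnot
  have := Submodule.finrank_sup_add_finrank_inf_eq (Submodule.span (ZMod 2) {wzero u})
    (P.map (phi u))
  rw [hdis, finrank_bot, finrank_span_singleton hne,
    ← (Submodule.equivMapOfInjective (phi u) (phi_injective u) P).finrank_eq] at this
  omega

theorem Finner_add_left {n : ℕ} (x y z : Fin n → ZMod 2) :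
    Finner (x + y) z = Finner x z + Finner y z := by
  simp [Finner, add_mul, Finset.sum_add_distrib]

theorem Finner_add_right {n : ℕ} (x y z : Fin n → ZMod 2) :
    Finner x (y + z) = Finner x y + Finner x z := by
  simp [Finner, mul_add, Finset.sum_add_distrib]

theorem Finner_smul_left {n : ℕ} (a : ZMod 2) (x z : Fin n → ZMod 2) :
    Finner (a • x) z = a * Finner x z := by
  simp [Finner, Finset.mul_sum, mul_assoc]

theorem Finner_smul_right {n : ℕ} (a : ZMod 2) (x z : Fin n → ZMod 2) :
    Finner x (a • z) = a * Finner x z := by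
  simp [Finner, Finset.mul_sum, mul_left_comm]

theorem Finner_comm {n : ℕ} (x z : Fin n → ZMod 2) : Finner x z = Finner z x := by
  simp [Finner, mul_comm]

theorem Finner_phi_phi {n : ℕ} (u x y : Fin n → ZMod 2) :
    Finner (phi u x) (phi u y) = Finner x y := by
  have h : Finner (phi u x) (phi u y)
      = Finner u x * Finner u y + (Finner u x * Finner u y + Finner x y) := by
    simp only [Finner, phi, Fin.sum_univ_succ, LinearMap.coe_mk, AddHom.coe_mk, Fin.cons_zero,
      Fin.cons_succ]
  rw [h, ← add_assoc, CharTwo.add_self_eq_zero, zero_add]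

theorem Finner_wzero_phi {n : ℕ} (u y : Fin n → ZMod 2) :
    Finner (wzero u) (phi u y) = 0 := by
  have h : Finner (wzero u) (phi u y) = 1 * Finner u y + (0 * Finner u y + Finner u y) := by
    simp only [Finner, phi, wzero, Fin.sum_univ_succ, LinearMap.coe_mk, AddHom.coe_mk,
      Fin.cons_zero, Fin.cons_succ]
  rw [h, one_mul, zero_mul, zero_add, CharTwo.add_self_eq_zero]

theorem Finner_wzero_wzero {n : ℕ} (u : Fin n → ZMod 2) (hu : Finner u u = 1) :
    Finner (wzero u) (wzero u) = 0 := by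
  have h : Finner (wzero u) (wzero u) = 1 * 1 + (0 * 0 + Finner u u) := by
    simp only [Finner, wzero, Fin.sum_univ_succ, Fin.cons_zero, Fin.cons_succ]
  rw [h, hu]; decide

/-- The hull as a submodule. -/
def hullSub {n : ℕ} (B : Submodule (ZMod 2) (Fin n → ZMod 2)) :
    Submodule (ZMod 2) (Fin n → ZMod 2) where
  carrier := FHull (B : Set (Fin n → ZMod 2))
  zero_mem' := ⟨B.zero_mem, fun w _ => by simp [Finner]⟩
  add_mem' := fun ha hb => ⟨B.add_mem ha.1 hb.1, fun w hw => by
    rw [Finner_add_right, ha.2 w hw, hb.2 w hw, add_zero]⟩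
  smul_mem' := fun c x hx => ⟨B.smul_mem c hx.1, fun w hw => by
    rw [Finner_smul_right, hx.2 w hw, mul_zero]⟩

theorem dimF_coe {n : ℕ} (B : Submodule (ZMod 2) (Fin n → ZMod 2)) :
    dimF (B : Set (Fin n → ZMod 2)) = Module.finrank (ZMod 2) B := by
  rw [dimF, Submodule.span_eq]

theorem dimF_FHull {n : ℕ} (B : Submodule (ZMod 2) (Fin n → ZMod 2)) :
    dimF (FHull (B : Set (Fin n → ZMod 2))) = Module.finrank (ZMod 2) (hullSub B) :=
  dimF_coe (hullSub B)

theorem mem_sup_iff {n : ℕ} (u : Fin n → ZMod 2) (P : Submodule (ZMod 2) (Fin n → ZMod 2)) (z) :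
    z ∈ Submodule.span (ZMod 2) {wzero u} ⊔ P.map (phi u) ↔
      ∃ c : ZMod 2, ∃ b ∈ P, c • wzero u + phi u b = z := by
  rw [Submodule.mem_sup]
  constructor
  · rintro ⟨y, hy, t, ⟨b, hb, rfl⟩, rfl⟩
    obtain ⟨c, rfl⟩ := Submodule.mem_span_singleton.1 hy
    exact ⟨c, b, hb, rfl⟩
  · rintro ⟨c, b, hb, rfl⟩
    exact ⟨_, Submodule.mem_span_singleton.2 ⟨c, rfl⟩, _, ⟨b, hb, rfl⟩, rfl⟩

theorem Finner_main {n : ℕ} (u : Fin n → ZMod 2) (hu : Finner u u = 1) (c d : ZMod 2)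
    (x y : Fin n → ZMod 2) :
    Finner (c • wzero u + phi u x) (d • wzero u + phi u y) = Finner x y := by
  rw [Finner_add_left, Finner_add_right, Finner_add_right, Finner_smul_left, Finner_smul_left,
    Finner_smul_right, Finner_smul_right, Finner_comm (phi u x) (wzero u), Finner_wzero_phi,
    Finner_wzero_phi, Finner_wzero_wzero u hu, Finner_phi_phi]
  ring

theorem hull_sup {n : ℕ} (u : Fin n → ZMod 2) (hu : Finner u u = 1)
    (B : Submodule (ZMod 2) (Fin n → ZMod 2)) :
    hullSub (Submodule.span (ZMod 2) {wzero u} ⊔ B.map (phi u)) =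
      Submodule.span (ZMod 2) {wzero u} ⊔ (hullSub B).map (phi u) := by
  ext z
  rw [mem_sup_iff]
  constructor
  · rintro ⟨hz, hz'⟩
    obtain ⟨c, b, hb, rfl⟩ := (mem_sup_iff u B z).1 hz
    refine ⟨c, b, ⟨hb, fun w hw => ?_⟩, rfl⟩
    have := hz' _ ((mem_sup_iff u B _).2 ⟨0, w, hw, rfl⟩)
    rwa [Finner_main u hu] at this
  · rintro ⟨c, b, hb, rfl⟩
    refine ⟨(mem_sup_iff u B _).2 ⟨c, b, hb.1, rfl⟩, fun w hw => ?_⟩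
    obtain ⟨d, e, he, rfl⟩ := (mem_sup_iff u B w).1 hw
    rw [Finner_main u hu]
    exact hb.2 e he

theorem cons2_kappa {n : ℕ} (a b : ZMod 2) (x : Fin n → ZMod 2) :
    cons2 (RingE.kappaSMul a) (RingE.kappaSMul b) (kappaVec x)
      = kappaVec (Fin.cons a (Fin.cons b x) : Fin (n + 2) → ZMod 2) := by
  funext i
  refine Fin.cases ?_ (fun i => Fin.cases ?_ (fun i => ?_) i) i <;> rfl

end ECode

open ECode RingE in
/-- Build-up Construction I: from a free `[n, k]`-code `C` with hull-rank
`l` and a vector `u` with `⟨u,u⟩ = 1`, the code `D` generated by `(κ, 0, κu)` together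
with the rows `(κvᵢ, κvᵢ, κrᵢ)` (where `vᵢ = ⟨u, rᵢ⟩`) is a free `[n+2, k+1]`-code with
hull-rank `l + 1`. -/
theorem buildup_construction_I {n k l : ℕ} (C : Set (Fin n → RingE)) (hC : IsECode C)
    (hfree : IsFree C) (r : Fin k → (Fin n → ZMod 2))
    (hli : LinearIndependent (ZMod 2) r)
    (hspan : (Submodule.span (ZMod 2) (Set.range r) : Set (Fin n → ZMod 2)) = Res C)
    (hl : dimF (FHull (Res C)) = l)
    (u : Fin n → ZMod 2) (hu : Finner u u = 1)
    (D : Set (Fin (n + 2) → RingE)) (hD : IsECode D)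
    (hgen : IsGenSet
      (insert (cons2 kappa 0 (kappaVec u))
        (Finset.image (fun i =>
          cons2 (kappaSMul (Finner u (r i))) (kappaSMul (Finner u (r i))) (kappaVec (r i)))
          Finset.univ)) D) :
    IsFree D ∧ dimF (Res D) = k + 1 ∧ dimF (FHull (Res D)) = l + 1 := by
  set B := Submodule.span (ZMod 2) (Set.range r) with hB
  have key := res_tor_of_gen (insert (wzero u) (Set.range fun i => phi u (r i))) _ (by
    rw [Finset.coe_insert, Finset.coe_image, Finset.coe_univ, Set.image_univ, Set.image_insert_eq,
      ← Set.range_comp]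
    congr 1
    · exact cons2_kappa 1 0 u
    · congr 1
      funext i
      exact cons2_kappa _ _ _) D hD hgen
  have hW : Submodule.span (ZMod 2) (insert (wzero u) (Set.range fun i => phi u (r i)))
      = Submodule.span (ZMod 2) {wzero u} ⊔ B.map (phi u) := by
    rw [Submodule.span_insert, hB, Submodule.map_span, ← Set.range_comp]
    rfl
  rw [hW] at key
  refine ⟨key.1.trans key.2.symm, ?_, ?_⟩
  · rw [key.1, dimF_coe, finrank_sup, hB, finrank_span_eq_card hli, Fintype.card_fin]
  · rw [key.1]
    rw [dimF_FHull, hull_sup u hu, finrank_sup, ← hl, ← hspan, dimF_FHull]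
end

section
/- (Build-up Construction IV.) Let C be a free E-linear code of length n with dim_{F₂}(C_Res) = k and hull-rank l, let r₁, …, r_k ∈ F₂ⁿ be a basis of C_Res, let u ∈ F₂ⁿ satisfy ⟨u, u⟩ = 0, and set vᵢ = ⟨u, rᵢ⟩ for 1 ≤ i ≤ k. Let D be the E-linear code of length n + 2 generated by the k + 1 vectors (κ, 0, κu₁, …, κu_n) and (κvᵢ, κvᵢ, κr_{i,1}, …, κr_{i,n}) for 1 ≤ i ≤ k. Then D is a free E-linear code of length n + 2 with dim_{F₂}(D_Res) = k + 1 and hull-rank l. -/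
open scoped BigOperators

namespace BuildUp
open ECode RingE

/-- Second coordinate as an additive hom. -/
def sndHom : RingE →+ ZMod 2 := AddMonoidHom.snd (ZMod 2) (ZMod 2)
/-- First coordinate as an additive hom. -/
def fstHom : RingE →+ ZMod 2 := AddMonoidHom.fst (ZMod 2) (ZMod 2)

def fstVec {n : ℕ} : (Fin n → RingE) →+ (Fin n → ZMod 2) := fstHom.compLeft (Fin n)
def sndVec {n : ℕ} : (Fin n → RingE) →+ (Fin n → ZMod 2) := sndHom.compLeft (Fin n)

theorem fstVec_smul {n : ℕ} (c : RingE) (x : Fin n → RingE) :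
    fstVec (smulVec c x) = fstHom c • fstVec x := rfl
theorem sndVec_smul {n : ℕ} (c : RingE) (x : Fin n → RingE) :
    sndVec (smulVec c x) = sndHom c • fstVec x := rfl

theorem res_tor {n : ℕ} (X : Finset (Fin n → RingE)) (hX : ∀ x ∈ X, sndVec x = 0)
    (D : Set (Fin n → RingE)) (hD : IsECode D) (hg : IsGenSet X D) :
    Res D = (Submodule.span (ZMod 2) (piVec '' (X : Set (Fin n → RingE))) : Set _) ∧
    Tor D = (Submodule.span (ZMod 2) (piVec '' (X : Set (Fin n → RingE))) : Set _) := by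
  classical
  obtain ⟨h0, hadd, hneg, hmul⟩ := hD
  have hsub : ∀ x ∈ X, fstVec x ∈
      Submodule.span (ZMod 2) (piVec '' (X : Set (Fin n → RingE))) :=
    fun x hx => Submodule.subset_span ⟨x, hx, rfl⟩
  have hXD : ∀ x ∈ X, x ∈ D := by
    intro x hx
    rw [← hg]
    exact Or.inr ⟨{x}, by simpa using hx, by simp⟩
  have key : ∀ y ∈ D, fstVec y ∈ Submodule.span (ZMod 2) (piVec '' (X : Set (Fin n → RingE))) ∧
      sndVec y ∈ Submodule.span (ZMod 2) (piVec '' (X : Set (Fin n → RingE))) := by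
    intro y hy
    rw [← hg] at hy
    rcases hy with ⟨c, rfl⟩ | ⟨S, hS, rfl⟩
    · rw [map_sum, map_sum]
      refine ⟨Submodule.sum_mem _ fun x hx => ?_, Submodule.sum_mem _ fun x hx => ?_⟩
      · rw [fstVec_smul]; exact Submodule.smul_mem _ _ (hsub x hx)
      · rw [sndVec_smul]; exact Submodule.smul_mem _ _ (hsub x hx)
    · rw [map_sum, map_sum]
      refine ⟨Submodule.sum_mem _ fun x hx => hsub x (hS hx), Submodule.sum_mem _ fun x hx => ?_⟩
      rw [hX x (hS hx)]; exact Submodule.zero_mem _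
  have two : ∀ a : ZMod 2, a = 0 ∨ a = 1 := by decide
  constructor
  · apply Set.Subset.antisymm
    · rintro _ ⟨y, hy, rfl⟩
      exact (key y hy).1
    · intro z hz
      induction hz using Submodule.span_induction with
      | mem x hx => obtain ⟨y, hy, rfl⟩ := hx; exact ⟨y, hXD y hy, rfl⟩
      | zero => exact ⟨0, h0, rfl⟩
      | add x y _ _ hx hy =>
        obtain ⟨a, ha, rfl⟩ := hx
        obtain ⟨b, hb, rfl⟩ := hy
        exact ⟨a + b, hadd a ha b hb, rfl⟩
      | smul a x _ hx =>
        rcases two a with rfl | rfl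
        · rw [zero_smul]; exact ⟨0, h0, rfl⟩
        · rwa [one_smul]
  · apply Set.Subset.antisymm
    · intro v hv
      exact (key _ hv).2
    · intro z hz
      induction hz using Submodule.span_induction with
      | mem x hx =>
        obtain ⟨y, hy, rfl⟩ := hx
        have h := hmul zeta y (hXD y hy)
        have e : zetaVec (piVec y) = fun i => zeta * y i := by
          funext i
          refine Prod.ext ?_ ?_
          · exact (zero_mul (y i).1).symm
          · exact (one_mul (y i).1).symm
        show zetaVec (piVec y) ∈ D
        rw [e]; exact h
      | zero => exact h0
      | add x y _ _ hx hy =>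
        have e : zetaVec (x + y) = zetaVec x + zetaVec y := by
          funext i
          exact Prod.ext (zero_add (0 : ZMod 2)).symm rfl
        show zetaVec (x + y) ∈ D
        rw [e]; exact hadd _ hx _ hy
      | smul a x _ hx =>
        rcases two a with rfl | rfl
        · rw [zero_smul]; exact h0
        · rwa [one_smul]

/-- The linear map `w ↦ (⟨u,w⟩, ⟨u,w⟩, w)`. -/
def phi {n : ℕ} (u : Fin n → ZMod 2) : (Fin n → ZMod 2) →ₗ[ZMod 2] (Fin (n + 2) → ZMod 2) where
  toFun w := Fin.cons (u ⬝ᵥ w) (Fin.cons (u ⬝ᵥ w) w : Fin (n + 1) → ZMod 2)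
  map_add' x y := by
    funext i
    refine Fin.cases ?_ (fun i => Fin.cases ?_ (fun i => ?_) i) i <;> simp [dotProduct_add]
  map_smul' a x := by
    funext i
    refine Fin.cases ?_ (fun i => Fin.cases ?_ (fun i => ?_) i) i <;> simp [dotProduct_smul]

/-- The vector `(1, 0, u)`. -/
def g0 {n : ℕ} (u : Fin n → ZMod 2) : Fin (n + 2) → ZMod 2 :=
  Fin.cons 1 (Fin.cons 0 u : Fin (n + 1) → ZMod 2)

theorem phi_inj {n : ℕ} (u : Fin n → ZMod 2) : Function.Injective (phi u) := by
  intro x y h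
  funext i
  exact congrFun h i.succ.succ

theorem inner_eq {n : ℕ} (u : Fin n → ZMod 2) (hu : Finner u u = 0) (a b : ZMod 2)
    (w z : Fin n → ZMod 2) :
    Finner (a • g0 u + phi u w) (b • g0 u + phi u z) = a * b + Finner w z := by
  have hu' : u ⬝ᵥ u = 0 := hu
  have h2 : ∀ s t a b : ZMod 2, (a + s) * (b + t) + s * t + (a * t + b * s) = a * b := by decide
  have e : Finner (a • g0 u + phi u w) (b • g0 u + phi u z) =
      (a + u ⬝ᵥ w) * (b + u ⬝ᵥ z) + ((u ⬝ᵥ w) * (u ⬝ᵥ z) + (a • u + w) ⬝ᵥ (b • u + z)) := by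
    unfold Finner
    rw [Fin.sum_univ_succ, Fin.sum_univ_succ]
    simp [g0, phi, dotProduct]
  rw [e, add_dotProduct, dotProduct_add, dotProduct_add, smul_dotProduct, smul_dotProduct,
    dotProduct_smul, dotProduct_smul, hu', dotProduct_comm w u]
  have := h2 (u ⬝ᵥ w) (u ⬝ᵥ z) a b
  show _ = a * b + w ⬝ᵥ z
  rw [← this]
  simp only [smul_eq_mul]
  ring

theorem mem_B {n k : ℕ} (u : Fin n → ZMod 2) (r : Fin k → (Fin n → ZMod 2))
    (x : Fin (n + 2) → ZMod 2) :
    x ∈ Submodule.span (ZMod 2) (insert (g0 u) (Set.range (phi u ∘ r))) ↔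
      ∃ a : ZMod 2, ∃ w ∈ Submodule.span (ZMod 2) (Set.range r), x = a • g0 u + phi u w := by
  rw [Submodule.mem_span_insert, Set.range_comp, Submodule.span_image]
  constructor
  · rintro ⟨a, _, ⟨w, hw, rfl⟩, h⟩
    exact ⟨a, w, hw, h⟩
  · rintro ⟨a, w, hw, h⟩
    exact ⟨a, _, ⟨w, hw, rfl⟩, h⟩

theorem hull_eq {n k : ℕ} (u : Fin n → ZMod 2) (hu : Finner u u = 0)
    (r : Fin k → (Fin n → ZMod 2)) :
    FHull (Submodule.span (ZMod 2) (insert (g0 u) (Set.range (phi u ∘ r))) : Set _) =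
      phi u '' FHull (Submodule.span (ZMod 2) (Set.range r) : Set _) := by
  ext x
  constructor
  · rintro ⟨hx, hd⟩
    obtain ⟨a, w, hw, rfl⟩ := (mem_B u r x).1 hx
    have ha : a = 0 := by
      have h := hd (1 • g0 u + phi u 0) ((mem_B u r _).2 ⟨1, 0, Submodule.zero_mem _, by simp⟩)
      have h' := inner_eq u hu 1 a 0 w
      simp only [one_smul] at h h'
      rw [h] at h'
      simpa [Finner] using h'.symm
    subst ha
    refine ⟨w, ⟨hw, fun z hz => ?_⟩, by simp⟩
    have h := hd ((0 : ZMod 2) • g0 u + phi u z) ((mem_B u r _).2 ⟨0, z, hz, rfl⟩)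
    rw [inner_eq u hu] at h
    simpa using h
  · rintro ⟨w, ⟨hw, hd⟩, rfl⟩
    refine ⟨(mem_B u r _).2 ⟨0, w, hw, by simp⟩, fun y hy => ?_⟩
    obtain ⟨b, z, hz, rfl⟩ := (mem_B u r y).1 hy
    have h := inner_eq u hu b 0 z w
    rw [zero_smul, zero_add] at h
    rw [h, hd z hz]
    simp

theorem dim_B {n k : ℕ} (u : Fin n → ZMod 2) (r : Fin k → (Fin n → ZMod 2))
    (hli : LinearIndependent (ZMod 2) r) :
    Module.finrank (ZMod 2)
      (Submodule.span (ZMod 2) (insert (g0 u) (Set.range (phi u ∘ r)))) = k + 1 := by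
  have h1 : LinearIndependent (ZMod 2) (phi u ∘ r) :=
    hli.map' (phi u) (LinearMap.ker_eq_bot.2 (phi_inj u))
  have h2 : g0 u ∉ Submodule.span (ZMod 2) (Set.range (phi u ∘ r)) := by
    rw [Set.range_comp, Submodule.span_image]
    rintro ⟨w, _, h⟩
    have e0 : u ⬝ᵥ w = 1 := congrFun h 0
    have e1 : u ⬝ᵥ w = 0 := congrFun h 1
    rw [e0] at e1
    exact one_ne_zero e1
  have h3 : LinearIndependent (ZMod 2) (Fin.cons (g0 u) (phi u ∘ r) :
      Fin (k + 1) → (Fin (n + 2) → ZMod 2)) := linearIndependent_finCons.2 ⟨h1, h2⟩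
  have h4 := finrank_span_eq_card h3
  rw [Fin.range_cons] at h4
  simpa using h4

end BuildUp

open ECode RingE in
/-- Build-up Construction IV: from a free `[n, k]`-code `C` with
hull-rank `l` and a vector `u` with `⟨u,u⟩ = 0`, the code `D` generated by `(κ, 0, κu)`
together with the rows `(κvᵢ, κvᵢ, κrᵢ)` (where `vᵢ = ⟨u, rᵢ⟩`) is a free
`[n+2, k+1]`-code with hull-rank `l`. -/
theorem buildup_construction_IV {n k l : ℕ} (C : Set (Fin n → RingE)) (hC : IsECode C)
    (hfree : IsFree C) (r : Fin k → (Fin n → ZMod 2))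
    (hli : LinearIndependent (ZMod 2) r)
    (hspan : (Submodule.span (ZMod 2) (Set.range r) : Set (Fin n → ZMod 2)) = Res C)
    (hl : dimF (FHull (Res C)) = l)
    (u : Fin n → ZMod 2) (hu : Finner u u = 0)
    (D : Set (Fin (n + 2) → RingE)) (hD : IsECode D)
    (hgen : IsGenSet
      (insert (cons2 kappa 0 (kappaVec u))
        (Finset.image (fun i =>
          cons2 (kappaSMul (Finner u (r i))) (kappaSMul (Finner u (r i))) (kappaVec (r i)))
          Finset.univ)) D) :
    IsFree D ∧ dimF (Res D) = k + 1 ∧ dimF (FHull (Res D)) = l := by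
  classical
  have hv0 : BuildUp.sndVec (cons2 kappa 0 (kappaVec u)) = 0 := by
    funext i
    refine Fin.cases ?_ (fun i => Fin.cases ?_ (fun i => ?_) i) i <;> rfl
  have hv : ∀ w : Fin n → ZMod 2, BuildUp.sndVec
      (cons2 (kappaSMul (Finner u w)) (kappaSMul (Finner u w)) (kappaVec w)) = 0 := by
    intro w
    funext i
    refine Fin.cases ?_ (fun i => Fin.cases ?_ (fun i => ?_) i) i <;> rfl
  have hp0 : piVec (cons2 kappa 0 (kappaVec u)) = BuildUp.g0 u := by
    funext i
    refine Fin.cases ?_ (fun i => Fin.cases ?_ (fun i => ?_) i) i <;> rfl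
  have hp : ∀ w : Fin n → ZMod 2, piVec
      (cons2 (kappaSMul (Finner u w)) (kappaSMul (Finner u w)) (kappaVec w)) =
        BuildUp.phi u w := by
    intro w
    funext i
    refine Fin.cases ?_ (fun i => Fin.cases ?_ (fun i => ?_) i) i <;> rfl
  obtain ⟨hR, hT⟩ := BuildUp.res_tor _ (by
    intro x hx
    rw [Finset.mem_insert, Finset.mem_image] at hx
    rcases hx with rfl | ⟨i, _, rfl⟩
    · exact hv0
    · exact hv _) D hD hgen
  refine ⟨hR.trans hT.symm, ?_⟩
  have hB : piVec '' ((insert (cons2 kappa 0 (kappaVec u))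
        (Finset.image (fun i =>
          cons2 (kappaSMul (Finner u (r i))) (kappaSMul (Finner u (r i))) (kappaVec (r i)))
          Finset.univ) : Finset (Fin (n + 2) → RingE)) : Set (Fin (n + 2) → RingE)) =
      insert (BuildUp.g0 u) (Set.range (BuildUp.phi u ∘ r)) := by
    rw [Finset.coe_insert, Set.image_insert_eq, hp0, Finset.coe_image, Finset.coe_univ,
      Set.image_univ, ← Set.range_comp]
    congr 2
    funext i
    exact hp (r i)
  rw [hB] at hR
  rw [hR]
  constructor
  · unfold dimF
    rw [Submodule.span_eq]
    exact BuildUp.dim_B u r hli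
  · rw [BuildUp.hull_eq u hu r, hspan, ← hl]
    unfold dimF
    rw [Submodule.span_image]
    exact (Submodule.equivMapOfInjective _ (BuildUp.phi_inj u) _).finrank_eq.symm
end
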